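/- arXiv:1605.06953 — 2 statements merged into one kernel-verified Lean document; each statement's English description precedes it below -/
import Mathlib

section
/- The presented group B₁₃ = ⟨x, y, z ∣ yzxy = zxyz, zxyzx = xyzxy⟩ is isomorphic to the Artin group of type I₂(6), presented as A = ⟨a, b ∣ ababab = bababa⟩. Explicitly, there is a group isomorphism φ : A → B₁₃ with φ(a) = zx and φ(b) = zxy(zx)⁻¹, whose inverse ψ : B₁₃ → A satisfies ψ(x) = (baba)⁻¹abaa, ψ(y) = a⁻¹ba, ψ(z) = (aba)⁻¹b(aba). -/
/-- The relations of the presentation `B₁₃ = ⟨x, y, z ∣ yzxy = zxyz, zxyzx = xyzxy⟩`,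
with `x, y, z` the generators indexed by `0, 1, 2 : Fin 3`. -/
def B13rels : Set (FreeGroup (Fin 3)) :=
  { FreeGroup.of 1 * FreeGroup.of 2 * FreeGroup.of 0 * FreeGroup.of 1 *
      (FreeGroup.of 2 * FreeGroup.of 0 * FreeGroup.of 1 * FreeGroup.of 2)⁻¹,
    FreeGroup.of 2 * FreeGroup.of 0 * FreeGroup.of 1 * FreeGroup.of 2 * FreeGroup.of 0 *
      (FreeGroup.of 0 * FreeGroup.of 1 * FreeGroup.of 2 * FreeGroup.of 0 * FreeGroup.of 1)⁻¹ }

/-- The braid group of `G₁₃`, presented as `⟨x, y, z ∣ yzxy = zxyz, zxyzx = xyzxy⟩`. -/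
abbrev B13 := PresentedGroup B13rels

/-- The relation of the Artin group of type `I₂(6)`, `⟨a, b ∣ ababab = bababa⟩`, with `a, b`
the generators indexed by `0, 1 : Fin 2`. -/
def I26rels : Set (FreeGroup (Fin 2)) :=
  { FreeGroup.of 0 * FreeGroup.of 1 * FreeGroup.of 0 * FreeGroup.of 1 * FreeGroup.of 0 *
      FreeGroup.of 1 *
      (FreeGroup.of 1 * FreeGroup.of 0 * FreeGroup.of 1 * FreeGroup.of 0 * FreeGroup.of 1 *
        FreeGroup.of 0)⁻¹ }

/-- The Artin group of type `I₂(6)`, presented as `⟨a, b ∣ ababab = bababa⟩`. -/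
abbrev ArtinI26 := PresentedGroup I26rels

local notation "x" => (PresentedGroup.of (rels := B13rels) 0)
local notation "y" => (PresentedGroup.of (rels := B13rels) 1)
local notation "z" => (PresentedGroup.of (rels := B13rels) 2)
local notation "a" => (PresentedGroup.of (rels := I26rels) 0)
local notation "b" => (PresentedGroup.of (rels := I26rels) 1)

/-- In any group, the relations of `B₁₃` imply the relation of `I₂(6)` for the images of the
generators under `φ`. -/
theorem artinI26_rel_of_B13_rels {G : Type*} [Group G] {p q r : G}
    (h₁ : q * r * p * q = r * p * q * r) (h₂ : r * p * q * r * p = p * q * r * p * q) :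
    (r * p) * (r * p * q * (r * p)⁻¹) * (r * p) * (r * p * q * (r * p)⁻¹) * (r * p) *
        (r * p * q * (r * p)⁻¹) =
      (r * p * q * (r * p)⁻¹) * (r * p) * (r * p * q * (r * p)⁻¹) * (r * p) *
        (r * p * q * (r * p)⁻¹) * (r * p) := by
  obtain ⟨d, hd⟩ : ∃ d, d = r * p * q := ⟨_, rfl⟩
  have hdr : r * p * d = d * d * r⁻¹ := by
    rw [eq_mul_inv_iff_mul_eq]
    calc r * p * d * r = r * p * (r * p * q * r) := by rw [hd]; group
      _ = r * p * (q * r * p * q) := by rw [h₁]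
      _ = d * d := by rw [hd]; group
  have hcomm : r * p * (d * d * d) = d * d * d * (r * p) :=
    calc r * p * (d * d * d) = r * p * d * (d * d) := by group
      _ = d * d * r⁻¹ * (d * d) := by rw [hdr]
      _ = d * d * (p * q * r * p * q) := by rw [hd]; group
      _ = d * d * (r * p * q * r * p) := by rw [h₂]
      _ = d * d * d * (r * p) := by rw [hd]; group
  calc _ = r * p * (d * d * d) * (r * p)⁻¹ := by rw [hd]; group
    _ = d * d * d := by rw [hcomm, mul_inv_cancel_right]
    _ = _ := by rw [hd]; group

/-- In any group, the relation of `I₂(6)` implies the second relation of `B₁₃` for the images of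
the generators under `ψ`. -/
theorem B13_rel_of_artinI26_rel {G : Type*} [Group G] {s t : G}
    (h : s * t * s * t * s * t = t * s * t * s * t * s) :
    ((s * t * s)⁻¹ * t * (s * t * s)) * ((t * s * t * s)⁻¹ * (s * t * s * s)) * (s⁻¹ * t * s) *
        ((s * t * s)⁻¹ * t * (s * t * s)) * ((t * s * t * s)⁻¹ * (s * t * s * s)) =
      ((t * s * t * s)⁻¹ * (s * t * s * s)) * (s⁻¹ * t * s) *
        ((s * t * s)⁻¹ * t * (s * t * s)) * ((t * s * t * s)⁻¹ * (s * t * s * s)) *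
        (s⁻¹ * t * s) :=
  calc _ = (t * s * t * s)⁻¹ * (t * s * t * s * t * s) * s := by group
    _ = (t * s * t * s)⁻¹ * (s * t * s * t * s * t) * s := by rw [h]
    _ = _ := by group

theorem B13_relations : y * z * x * y = z * x * y * z ∧ z * x * y * z * x = x * y * z * x * y :=
  ⟨mul_inv_eq_one.mp (PresentedGroup.one_of_mem (rels := B13rels) (Or.inl rfl)),
    mul_inv_eq_one.mp (PresentedGroup.one_of_mem (rels := B13rels) (Or.inr rfl))⟩

theorem artinI26_relation : a * b * a * b * a * b = b * a * b * a * b * a :=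
  mul_inv_eq_one.mp (PresentedGroup.one_of_mem (rels := I26rels) rfl)

/-- The homomorphism `φ : A → B₁₃`. -/
def artinI26ToB13 : ArtinI26 →* B13 :=
  PresentedGroup.toGroup (f := ![z * x, z * x * y * (z * x)⁻¹]) <| by
    rintro _ rfl
    simpa only [map_mul, map_inv, FreeGroup.lift_apply_of, Matrix.cons_val, mul_inv_eq_one] using
      artinI26_rel_of_B13_rels B13_relations.1 B13_relations.2

/-- The homomorphism `ψ : B₁₃ → A`. -/
def B13ToArtinI26 : B13 →* ArtinI26 :=
  PresentedGroup.toGroup (f := ![(b * a * b * a)⁻¹ * (a * b * a * a), a⁻¹ * b * a,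
      (a * b * a)⁻¹ * b * (a * b * a)]) <| by
    rintro _ (rfl | rfl) <;>
      simp only [map_mul, map_inv, FreeGroup.lift_apply_of, Matrix.cons_val, mul_inv_eq_one]
    · group
    · exact B13_rel_of_artinI26_rel artinI26_relation

theorem artinI26ToB13_a : artinI26ToB13 a = z * x := PresentedGroup.toGroup.of _

theorem artinI26ToB13_b : artinI26ToB13 b = z * x * y * (z * x)⁻¹ := PresentedGroup.toGroup.of _

theorem B13ToArtinI26_x : B13ToArtinI26 x = (b * a * b * a)⁻¹ * (a * b * a * a) :=
  PresentedGroup.toGroup.of _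

theorem B13ToArtinI26_y : B13ToArtinI26 y = a⁻¹ * b * a := PresentedGroup.toGroup.of _

theorem B13ToArtinI26_z : B13ToArtinI26 z = (a * b * a)⁻¹ * b * (a * b * a) :=
  PresentedGroup.toGroup.of _

theorem B13ToArtinI26_comp_artinI26ToB13 :
    B13ToArtinI26.comp artinI26ToB13 = MonoidHom.id ArtinI26 := by
  refine PresentedGroup.ext fun i => ?_
  fin_cases i
  · change B13ToArtinI26 (artinI26ToB13 a) = a
    simp only [artinI26ToB13_a, map_mul, B13ToArtinI26_x, B13ToArtinI26_z]
    group
  · change B13ToArtinI26 (artinI26ToB13 b) = b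
    simp only [artinI26ToB13_b, map_mul, map_inv, B13ToArtinI26_x, B13ToArtinI26_y,
      B13ToArtinI26_z]
    group

theorem artinI26ToB13_comp_B13ToArtinI26 :
    artinI26ToB13.comp B13ToArtinI26 = MonoidHom.id B13 := by
  have hz : artinI26ToB13 (B13ToArtinI26 z) = z :=
    calc _ = (z * x * y)⁻¹ * (y * z * x * y) := by
          simp only [B13ToArtinI26_z, map_mul, map_inv, artinI26ToB13_a, artinI26ToB13_b]
          group
      _ = z := by rw [B13_relations.1]; group
  refine PresentedGroup.ext fun i => ?_
  fin_cases i
  · change artinI26ToB13 (B13ToArtinI26 x) = x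
    have hx : B13ToArtinI26 x = (B13ToArtinI26 z)⁻¹ * a := by
      rw [B13ToArtinI26_x, B13ToArtinI26_z]
      group
    rw [hx, map_mul, map_inv, hz, artinI26ToB13_a, inv_mul_cancel_left]
  · change artinI26ToB13 (B13ToArtinI26 y) = y
    simp only [B13ToArtinI26_y, map_mul, map_inv, artinI26ToB13_a, artinI26ToB13_b]
    group
  · exact hz

/-- There is a group isomorphism `φ : A ≃ B₁₃` with `φ(a) = zx`, `φ(b) = zxy(zx)⁻¹`, whose
inverse `ψ` satisfies `ψ(x) = (baba)⁻¹abaa`, `ψ(y) = a⁻¹ba`, `ψ(z) = (aba)⁻¹b(aba)`. -/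
theorem B13_iso_artin_I26 :
    ∃ φ : ArtinI26 ≃* B13,
      φ a = z * x ∧
      φ b = z * x * y * (z * x)⁻¹ ∧
      φ.symm x = (b * a * b * a)⁻¹ * (a * b * a * a) ∧
      φ.symm y = a⁻¹ * b * a ∧
      φ.symm z = (a * b * a)⁻¹ * b * (a * b * a) := by
  exact ⟨artinI26ToB13.toMulEquiv B13ToArtinI26 B13ToArtinI26_comp_artinI26ToB13
    artinI26ToB13_comp_B13ToArtinI26, artinI26ToB13_a, artinI26ToB13_b, B13ToArtinI26_x,
    B13ToArtinI26_y, B13ToArtinI26_z⟩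
end

section
/- Let R = ℤ[t, t⁻¹] be the ring of integer Laurent polynomials, and consider R-linear maps d₂ : R → R² given by d₂(c) = (−(1+t³+t⁶)(1−t)·c, (1+t³+t⁶)(1−t)(1+t)·c) and d₁ : R² → R given by d₁(p, q) = (t²−1)p + (t−1)q. Then d₁ ∘ d₂ = 0, and the homology of the resulting complex R → R² → R is: R/im(d₁) ≅ ℤ as an abelian group, ker(d₁)/im(d₂) ≅ R/((1−t)(1+t³+t⁶)) as an R-module, and ker(d₂) = 0. -/
open LaurentPolynomial

/-- The ring `R = ℤ[t, t⁻¹]` of integer Laurent polynomials. -/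
abbrev RZ := LaurentPolynomial ℤ

/-- `d₂ : R → R²`, `c ↦ (−(1+t³+t⁶)(1−t)·c, (1+t³+t⁶)(1−t)(1+t)·c)`. -/
noncomputable def dtwo : RZ →ₗ[RZ] RZ × RZ :=
  LinearMap.prod
    (LinearMap.toSpanSingleton RZ RZ (-((1 + T 3 + T 6) * (1 - T 1))))
    (LinearMap.toSpanSingleton RZ RZ ((1 + T 3 + T 6) * (1 - T 1) * (1 + T 1)))

/-- `d₁ : R² → R`, `(p, q) ↦ (t²−1)p + (t−1)q`. -/
noncomputable def done : RZ × RZ →ₗ[RZ] RZ :=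
  LinearMap.coprod
    (LinearMap.toSpanSingleton RZ RZ (T 2 - 1))
    (LinearMap.toSpanSingleton RZ RZ (T 1 - 1))

/-- The augmentation `ℤ[t, t⁻¹] → ℤ`, `t ↦ 1`. -/
noncomputable def augmentation : RZ →+* ℤ := LaurentPolynomial.eval₂ (RingHom.id ℤ) 1

lemma augmentation_T (n : ℤ) : augmentation (T n) = 1 := by
  simp [augmentation]

lemma augmentation_C (a : ℤ) : augmentation (C a) = a := by
  simp [augmentation]

lemma T_one_sub_one_ne_zero : (T 1 - 1 : RZ) ≠ 0 := by
  rw [sub_ne_zero, ← T_zero]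
  intro h
  have h1 := congrArg (fun f : RZ => AddMonoidAlgebra.coeff f 1) h
  simp only [T_apply] at h1
  norm_num at h1

lemma one_add_T_three_add_T_six_ne_zero : (1 + T 3 + T 6 : RZ) ≠ 0 := by
  intro h
  have h1 := congrArg augmentation h
  simp [augmentation_T] at h1

lemma one_sub_T_one_mul_ne_zero : ((1 - T 1) * (1 + T 3 + T 6) : RZ) ≠ 0 :=
  mul_ne_zero (neg_sub (T 1 : RZ) 1 ▸ neg_ne_zero.mpr T_one_sub_one_ne_zero)
    one_add_T_three_add_T_six_ne_zero

lemma T_two_eq_sq : (T 2 : RZ) = T 1 ^ 2 := by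
  rw [T_pow]
  norm_num

lemma T_one_sub_one_dvd_sub_augmentation (f : RZ) : T 1 - 1 ∣ f - C (augmentation f) := by
  induction f using LaurentPolynomial.induction_on with
  | h_C a => simp
  | h_add hp hq =>
    rw [map_add, map_add, add_sub_add_comm]
    exact dvd_add hp hq
  | h_C_mul_T n a h =>
    simp only [map_mul, augmentation_T, augmentation_C, mul_one] at h ⊢
    rw [T_add]
    convert dvd_add h (Dvd.intro_left (C a * T (n : ℤ)) rfl) using 1
    ring
  | h_C_mul_T_Z n a h =>
    simp only [map_mul, augmentation_T, augmentation_C, mul_one] at h ⊢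
    have hT : (T (-(n : ℤ)) : RZ) = T (-(n : ℤ) - 1) * T 1 := by
      rw [← T_add, sub_add_cancel]
    rw [hT] at h
    convert dvd_sub h (Dvd.intro_left (C a * T (-(n : ℤ) - 1)) rfl) using 1
    ring

lemma dtwo_apply (c : RZ) : dtwo c = (-((1 + T 3 + T 6) * (1 - T 1)) * c,
    (1 + T 3 + T 6) * (1 - T 1) * (1 + T 1) * c) := by
  simp only [dtwo, LinearMap.prod_apply, Function.prod_apply, LinearMap.toSpanSingleton_apply,
    smul_eq_mul, mul_comm c]

lemma done_apply (p q : RZ) : done (p, q) = (T 2 - 1) * p + (T 1 - 1) * q := by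
  simp only [done, LinearMap.coprod_apply, LinearMap.toSpanSingleton_apply, smul_eq_mul,
    mul_comm]

lemma mem_ker_done_iff (p q : RZ) : (p, q) ∈ LinearMap.ker done ↔ q = -(1 + T 1) * p := by
  rw [LinearMap.mem_ker, done_apply, T_two_eq_sq,
    show (T 1 ^ 2 - 1) * p + (T 1 - 1) * q = (T 1 - 1) * (q - -(1 + T 1) * p) by ring,
    mul_eq_zero, or_iff_right T_one_sub_one_ne_zero, sub_eq_zero]

lemma range_done : LinearMap.range done = RingHom.ker augmentation := by
  ext f
  rw [LinearMap.mem_range, RingHom.mem_ker]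
  constructor
  · rintro ⟨⟨p, q⟩, rfl⟩
    simp [done_apply, augmentation_T]
  · intro hf
    obtain ⟨q, hq⟩ := T_one_sub_one_dvd_sub_augmentation f
    refine ⟨(0, q), ?_⟩
    rw [done_apply, ← hq, hf]
    simp

/-- The kernel of `d₁` is free of rank one, generated by `(−1, 1 + t)`. -/
noncomputable def kerDoneEquiv : LinearMap.ker done ≃ₗ[RZ] RZ where
  toFun x := -x.1.1
  map_add' x y := by simp [add_comm]
  map_smul' r x := by simp
  invFun p := ⟨(-p, (1 + T 1) * p), (mem_ker_done_iff _ _).mpr (by ring)⟩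
  left_inv := by
    rintro ⟨⟨p, q⟩, h⟩
    simp [(mem_ker_done_iff p q).mp h]
    ring
  right_inv p := by simp

lemma map_kerDoneEquiv_range_dtwo :
    ((LinearMap.range dtwo).comap (LinearMap.ker done).subtype).map
      (kerDoneEquiv : LinearMap.ker done →ₗ[RZ] RZ) =
    Ideal.span {((1 - T 1) * (1 + T 3 + T 6) : RZ)} := by
  ext f
  rw [Ideal.mem_span_singleton']
  constructor
  · rintro ⟨⟨x, hx⟩, ⟨c, rfl⟩, rfl⟩
    refine ⟨c, ?_⟩
    simp only [kerDoneEquiv, dtwo_apply, LinearMap.coe_mk, AddHom.coe_mk]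
    ring
  · rintro ⟨c, rfl⟩
    refine ⟨kerDoneEquiv.symm (c * ((1 - T 1) * (1 + T 3 + T 6))), ⟨c, ?_⟩,
      kerDoneEquiv.apply_symm_apply _⟩
    rw [dtwo_apply]
    refine Prod.ext ?_ ?_ <;> simp [kerDoneEquiv] <;> ring

/-- `d₁ ∘ d₂ = 0`, and the homology of `R → R² → R` is: `R/im(d₁) ≅ ℤ` as an abelian group,
`ker(d₁)/im(d₂) ≅ R/((1−t)(1+t³+t⁶))` as an `R`-module, and `ker(d₂) = 0`. -/
theorem milnor_fiber_complex_G13 :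
    (∀ c : RZ, dtwo c = (-((1 + T 3 + T 6) * (1 - T 1)) * c,
        (1 + T 3 + T 6) * (1 - T 1) * (1 + T 1) * c)) ∧
    (∀ p q : RZ, done (p, q) = (T 2 - 1) * p + (T 1 - 1) * q) ∧
    done.comp dtwo = 0 ∧
    Nonempty ((RZ ⧸ LinearMap.range done) ≃+ ℤ) ∧
    Nonempty ((LinearMap.ker done ⧸
        (LinearMap.range dtwo).comap (LinearMap.ker done).subtype) ≃ₗ[RZ]
      RZ ⧸ Ideal.span {((1 - T 1) * (1 + T 3 + T 6) : RZ)}) ∧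
    LinearMap.ker dtwo = ⊥ := by
  refine ⟨dtwo_apply, done_apply, ?_, ?_, ?_, ?_⟩
  · refine LinearMap.ext fun c => ?_
    rw [LinearMap.comp_apply, dtwo_apply, LinearMap.zero_apply, ← LinearMap.mem_ker]
    exact (mem_ker_done_iff _ _).mpr (by ring)
  · rw [range_done]
    exact ⟨(RingHom.quotientKerEquivOfSurjective (f := augmentation)
      fun a => ⟨C a, augmentation_C a⟩).toAddEquiv⟩
  · exact ⟨Submodule.Quotient.equiv _ _ kerDoneEquiv map_kerDoneEquiv_range_dtwo⟩
  · refine (Submodule.eq_bot_iff _).mpr fun c hc => ?_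
    rw [LinearMap.mem_ker, dtwo_apply] at hc
    have h := congrArg Prod.fst hc
    rw [Prod.fst_zero, mul_comm (1 + T 3 + T 6 : RZ)] at h
    exact (mul_eq_zero.mp h).resolve_left (neg_ne_zero.mpr one_sub_T_one_mul_ne_zero)
end
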